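/- For any UCQ 𝒬 and finite set ℛ of disjunctive existential rules: if (𝒬, ℛ) admits a UCQ-rewriting 𝒬', then there is an i ≥ 0 such that 𝒬' is logically equivalent to W_i(𝒬, ℛ). -/

import Mathlib

/-! ## Basic syntax: terms, atoms, substitutions -/

/-- A term over variables `V` and constants `C`. -/
inductive FOTerm (V C : Type) where
  | var (v : V)
  | const (c : C)
deriving DecidableEq

/-- An atom `p(t_1,...,t_n)`. -/
structure FOAtom (P V C : Type) where
  pred : P
  args : List (FOTerm V C)
deriving DecidableEq

/-- A substitution of variables by terms. -/
abbrev FOSubst (V C : Type) := V → FOTerm V C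

variable {P V C : Type}

def FOTerm.applySub (u : FOSubst V C) : FOTerm V C → FOTerm V C
  | FOTerm.var v => u v
  | FOTerm.const c => FOTerm.const c

def FOAtom.applySub (u : FOSubst V C) (a : FOAtom P V C) : FOAtom P V C :=
  ⟨a.pred, a.args.map (FOTerm.applySub u)⟩

def applySubFS [DecidableEq P] [DecidableEq V] [DecidableEq C]
    (u : FOSubst V C) (S : Finset (FOAtom P V C)) : Finset (FOAtom P V C) :=
  S.image (FOAtom.applySub u)

def FOTerm.varsOf [DecidableEq V] : FOTerm V C → Finset V
  | FOTerm.var v => {v}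
  | FOTerm.const _ => ∅

def FOAtom.varsOf [DecidableEq V] (a : FOAtom P V C) : Finset V :=
  a.args.foldr (fun t acc => t.varsOf ∪ acc) ∅

/-- Variables occurring in a finite set of atoms. -/
def varsFS [DecidableEq V] (S : Finset (FOAtom P V C)) : Finset V :=
  S.sup FOAtom.varsOf

/-- Terms occurring in a finite set of atoms. -/
def termsFS [DecidableEq V] [DecidableEq C] (S : Finset (FOAtom P V C)) :
    Finset (FOTerm V C) :=
  S.sup (fun a => a.args.toFinset)

/-- `h` is a homomorphism from the atom set `S₁` to the atom set `S₂`. -/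
def IsHom (h : FOSubst V C) (S₁ S₂ : Finset (FOAtom P V C)) : Prop :=
  ∀ a ∈ S₁, a.applySub h ∈ S₂

/-- `S₂ ⊨ S₁` for atom sets viewed as existentially closed conjunctions:
there is a homomorphism from `S₁` to `S₂`. -/
def EntailsFS (S₂ S₁ : Finset (FOAtom P V C)) : Prop :=
  ∃ h : FOSubst V C, IsHom h S₁ S₂

/-! ## Disjunctive existential rules, triggers, chase step α -/

/-- A disjunctive existential rule `B → H₁ ∨ ... ∨ Hₙ`. -/
structure DisjRule (P V C : Type) where
  body : Finset (FOAtom P V C)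
  heads : List (Finset (FOAtom P V C))

/-- Well-formedness: non-empty body, at least one head disjunct, non-empty disjuncts. -/
def DisjRule.WF (R : DisjRule P V C) : Prop :=
  R.body.Nonempty ∧ R.heads ≠ [] ∧ ∀ H ∈ R.heads, H.Nonempty

/-- All variables of a rule. -/
def DisjRule.vars [DecidableEq V] (R : DisjRule P V C) : Finset V :=
  varsFS R.body ∪ R.heads.foldr (fun H acc => varsFS H ∪ acc) ∅

/-- A trigger `(R, h)` on `F`: `h` is a homomorphism from the body of `R` to `F`. -/
def IsTrigger (R : DisjRule P V C) (h : FOSubst V C) (F : Finset (FOAtom P V C)) : Prop :=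
  IsHom h R.body F

/-- `h'` is a safe extension of `h` for the head disjunct `H` of rule `R` w.r.t. the
fact base `F`: it agrees with `h` outside the existential variables of `H` and renames
the existential variables of `H` injectively to fresh variables. -/
def IsSafeExt [DecidableEq V] (F : Finset (FOAtom P V C)) (R : DisjRule P V C)
    (H : Finset (FOAtom P V C)) (h h' : FOSubst V C) : Prop :=
  (∀ v : V, v ∉ varsFS H \ varsFS R.body → h' v = h v) ∧
  (∀ v ∈ varsFS H \ varsFS R.body, ∃ w : V, h' v = FOTerm.var w ∧ w ∉ varsFS F) ∧
  (∀ v ∈ varsFS H \ varsFS R.body, ∀ v' ∈ varsFS H \ varsFS R.body,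
      h' v = h' v' → v = v')

/-- `L` is a result of the application `α_∨(F, R, h)` of the trigger `(R, h)` on `F`:
its `i`-th element is `F ∪ h^{safeᵢ}(Hᵢ)`. -/
def IsAlpha [DecidableEq P] [DecidableEq V] [DecidableEq C]
    (F : Finset (FOAtom P V C)) (R : DisjRule P V C) (h : FOSubst V C)
    (L : List (Finset (FOAtom P V C))) : Prop :=
  L.length = R.heads.length ∧
  ∀ (i : ℕ) (hi : i < L.length) (hi' : i < R.heads.length),
    ∃ h' : FOSubst V C, IsSafeExt F R (R.heads.get ⟨i, hi'⟩) h h' ∧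
      L.get ⟨i, hi⟩ = F ∪ applySubFS h' (R.heads.get ⟨i, hi'⟩)

/-! ## Partitions of terms (as equivalence relations), piece-unifiers -/

/-- A relation on terms, representing a partition of a set of terms (two terms are
related iff they belong to the same class). -/
abbrev TRel (V C : Type) := FOTerm V C → FOTerm V C → Prop

/-- Admissibility of a partition: no class contains two distinct constants. -/
def RelAdmissible (r : TRel V C) : Prop :=
  ∀ c c' : C, r (FOTerm.const c) (FOTerm.const c') → c = c'

/-- `u` is a substitution associated with the partition represented by `r`:
it is constant on classes, maps each term to a member of its class (the selected term),
and gives priority to constants. -/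
def IsAssocSub (r : TRel V C) (u : FOSubst V C) : Prop :=
  (∀ s t, r s t → s.applySub u = t.applySub u) ∧
  (∀ t, r t (t.applySub u)) ∧
  (∀ (v : V) (c : C), r (FOTerm.var v) (FOTerm.const c) → u v = FOTerm.const c)

/-- The data of a piece-unifier `(Q', H', P_u)`. -/
structure PieceUnif (P V C : Type) where
  Q' : Finset (FOAtom P V C)
  H' : Finset (FOAtom P V C)
  rel : TRel V C

/-- `μ` is a piece-unifier of the CQ `Q` with the conjunctive rule `B → H`. -/
def IsPieceUnifier [DecidableEq P] [DecidableEq V] [DecidableEq C]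
    (Q : Finset (FOAtom P V C)) (B H : Finset (FOAtom P V C))
    (μ : PieceUnif P V C) : Prop :=
  μ.Q'.Nonempty ∧ μ.Q' ⊆ Q ∧ μ.H' ⊆ H ∧
  Equivalence μ.rel ∧
  -- the partition is on the terms of Q' and H' (all other classes are singletons)
  (∀ s t, μ.rel s t → s = t ∨
      (s ∈ termsFS μ.Q' ∪ termsFS μ.H' ∧ t ∈ termsFS μ.Q' ∪ termsFS μ.H')) ∧
  RelAdmissible μ.rel ∧
  -- classes containing an existential variable of H' contain otherwise only
  -- non-separating variables of Q'
  (∀ z ∈ varsFS μ.H' \ varsFS B, ∀ t, μ.rel (FOTerm.var z) t → t = FOTerm.var z ∨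
      ∃ v : V, t = FOTerm.var v ∧ FOTerm.var v ∈ termsFS μ.Q' ∧ v ∉ varsFS (Q \ μ.Q')) ∧
  -- unification condition
  (∀ u : FOSubst V C, IsAssocSub μ.rel u → applySubFS u μ.Q' = applySubFS u μ.H')

/-- The join of a list of partitions (represented as relations): the equivalence
relation generated by their union. -/
def joinRel (rs : List (TRel V C)) : TRel V C :=
  Relation.EqvGen (fun s t => ∃ r ∈ rs, r s t)

/-- The data of a disjunctive piece-unifier: the safe copies `Q₁, ..., Qₙ` together
with the conjunctive piece-unifiers `μ₁, ..., μₙ`. -/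
structure DisjPieceUnif (P V C : Type) where
  Qs : List (Finset (FOAtom P V C))
  mus : List (PieceUnif P V C)

/-- The join of the partitions of a disjunctive piece-unifier. -/
def DisjPieceUnif.rel (μ : DisjPieceUnif P V C) : TRel V C :=
  joinRel (μ.mus.map PieceUnif.rel)

/-- `Qc` is a safe copy of `Q` (bijective renaming of its variables). -/
def IsSafeCopy [DecidableEq P] [DecidableEq V] [DecidableEq C]
    (Q Qc : Finset (FOAtom P V C)) : Prop :=
  ∃ ρ : V → V, Function.Injective ρ ∧
    Qc = Q.image (FOAtom.applySub (fun v => FOTerm.var (ρ v)))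

/-- `μ` is a disjunctive piece-unifier of the UCQ `𝒬` with the disjunctive rule `R`. -/
def IsDisjPieceUnifier [DecidableEq P] [DecidableEq V] [DecidableEq C]
    (𝒬 : Set (Finset (FOAtom P V C))) (R : DisjRule P V C)
    (μ : DisjPieceUnif P V C) : Prop :=
  μ.Qs.length = R.heads.length ∧ μ.mus.length = R.heads.length ∧
  -- each Qᵢ is a safe copy of a CQ of 𝒬, with variables disjoint from the rule
  -- and from the other copies
  (∀ (i : ℕ) (hi : i < μ.Qs.length), ∃ Q ∈ 𝒬, IsSafeCopy Q (μ.Qs.get ⟨i, hi⟩)) ∧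
  (∀ (i : ℕ) (hi : i < μ.Qs.length), Disjoint (varsFS (μ.Qs.get ⟨i, hi⟩)) R.vars) ∧
  (∀ (i j : ℕ) (hi : i < μ.Qs.length) (hj : j < μ.Qs.length), i ≠ j →
      Disjoint (varsFS (μ.Qs.get ⟨i, hi⟩)) (varsFS (μ.Qs.get ⟨j, hj⟩))) ∧
  -- each μᵢ is a piece-unifier of Qᵢ with B → Hᵢ
  (∀ (i : ℕ) (hi : i < R.heads.length) (hi1 : i < μ.Qs.length) (hi2 : i < μ.mus.length),
      IsPieceUnifier (μ.Qs.get ⟨i, hi1⟩) R.body (R.heads.get ⟨i, hi⟩)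
        (μ.mus.get ⟨i, hi2⟩)) ∧
  -- the join of the partitions is admissible
  RelAdmissible μ.rel

/-- `β_∨(𝒬, R, μ) = u(B) ∪ ⋃ᵢ u(Qᵢ ∖ Qᵢ')`, for `u` a substitution associated with
the join of the partitions of `μ`. -/
def betaRw [DecidableEq P] [DecidableEq V] [DecidableEq C]
    (R : DisjRule P V C) (μ : DisjPieceUnif P V C) (u : FOSubst V C) :
    Finset (FOAtom P V C) :=
  applySubFS u R.body ∪
    (List.zipWith (fun Qi m => applySubFS u (Qi \ PieceUnif.Q' m)) μ.Qs μ.mus).foldr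
      (· ∪ ·) ∅

/-! ## Semantics -/

/-- A first-order interpretation (with non-empty domain). -/
structure Interp (P V C : Type) where
  dom : Type
  nonempty : Nonempty dom
  rel : P → List dom → Prop
  cst : C → dom

def Interp.evalT (I : Interp P V C) (a : V → I.dom) : FOTerm V C → I.dom
  | FOTerm.var v => a v
  | FOTerm.const c => I.cst c

def Interp.satAtom (I : Interp P V C) (a : V → I.dom) (atm : FOAtom P V C) : Prop :=
  I.rel atm.pred (atm.args.map (I.evalT a))

def Interp.satFS (I : Interp P V C) (a : V → I.dom) (S : Finset (FOAtom P V C)) : Prop :=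
  ∀ atm ∈ S, I.satAtom a atm

/-- `I` is a model of the atom set `S` viewed as an existentially closed conjunction. -/
def Interp.modelsFB [DecidableEq V] (I : Interp P V C) (S : Finset (FOAtom P V C)) : Prop :=
  ∃ a : V → I.dom, I.satFS a S

/-- `I` satisfies the disjunctive existential rule `R`. -/
def Interp.satRule [DecidableEq V] (I : Interp P V C) (R : DisjRule P V C) : Prop :=
  ∀ a : V → I.dom, I.satFS a R.body →
    ∃ H ∈ R.heads, ∃ a' : V → I.dom,
      (∀ v ∈ varsFS R.body, a' v = a v) ∧ I.satFS a' H

/-- First-order entailment `F, ℛ ⊨ 𝒬` of a UCQ from a fact base and a set of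
disjunctive existential rules. -/
def SemEntails [DecidableEq V] (F : Finset (FOAtom P V C)) (ℛ : Set (DisjRule P V C))
    (𝒬 : Set (Finset (FOAtom P V C))) : Prop :=
  ∀ I : Interp P V C, I.modelsFB F → (∀ R ∈ ℛ, I.satRule R) →
    ∃ Q ∈ 𝒬, I.modelsFB Q

/-! ## Piece-rewriting -/

/-- `IsPieceRewriting ℛ 𝒬 𝒬'` holds when the UCQ `𝒬'` is obtained from the UCQ `𝒬`
by a finite sequence of one-step piece-rewritings with rules of `ℛ`. -/
inductive IsPieceRewriting [DecidableEq P] [DecidableEq V] [DecidableEq C]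
    (ℛ : Set (DisjRule P V C)) :
    Finset (Finset (FOAtom P V C)) → Finset (Finset (FOAtom P V C)) → Prop
  | refl (𝒬 : Finset (Finset (FOAtom P V C))) : IsPieceRewriting ℛ 𝒬 𝒬
  | step (𝒬 𝒬' : Finset (Finset (FOAtom P V C))) (R : DisjRule P V C)
      (μ : DisjPieceUnif P V C) (u : FOSubst V C) :
      IsPieceRewriting ℛ 𝒬 𝒬' → R ∈ ℛ →
      IsDisjPieceUnifier (↑𝒬' : Set (Finset (FOAtom P V C))) R μ →
      IsAssocSub μ.rel u →
      IsPieceRewriting ℛ 𝒬 (insert (betaRw R μ u) 𝒬')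

/-- The breadth-first rewriting operator `W`. -/
def Wop {P V C : Type} [DecidableEq P] [DecidableEq V] [DecidableEq C]
    (𝒬 : Finset (Finset (FOAtom P V C))) (ℛ : Set (DisjRule P V C)) :
    ℕ → Set (Finset (FOAtom P V C))
  | 0 => ↑𝒬
  | (i + 1) =>
      Wop 𝒬 ℛ i ∪
        { q | ∃ R ∈ ℛ, ∃ (μ : DisjPieceUnif P V C) (u : FOSubst V C),
            IsDisjPieceUnifier (Wop 𝒬 ℛ i) R μ ∧ IsAssocSub μ.rel u ∧
            q = betaRw R μ u }

/-! ## Variables and terms of atom sets -/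

theorem mem_varsOf [DecidableEq V] {a : FOAtom P V C} {v : V} :
    v ∈ a.varsOf ↔ FOTerm.var v ∈ a.args := by
  obtain ⟨p, l⟩ := a
  unfold FOAtom.varsOf
  induction l with
  | nil => simp
  | cons t l ih =>
    simp only [List.foldr_cons, Finset.mem_union, List.mem_cons, ih]
    cases t <;> simp [FOTerm.varsOf]

theorem mem_varsFS [DecidableEq V] {S : Finset (FOAtom P V C)} {v : V} :
    v ∈ varsFS S ↔ ∃ a ∈ S, FOTerm.var v ∈ a.args := by
  simp [varsFS, Finset.mem_sup, mem_varsOf]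

theorem mem_termsFS [DecidableEq V] [DecidableEq C] {S : Finset (FOAtom P V C)}
    {t : FOTerm V C} : t ∈ termsFS S ↔ ∃ a ∈ S, t ∈ a.args := by
  simp [termsFS, Finset.mem_sup]

theorem varsFS_mono [DecidableEq V] {S T : Finset (FOAtom P V C)} (h : S ⊆ T) :
    varsFS S ⊆ varsFS T :=
  Finset.sup_mono h

theorem mem_foldr_union {α : Type*} [DecidableEq α] {L : List (Finset α)} {a : α} :
    a ∈ L.foldr (· ∪ ·) ∅ ↔ ∃ S ∈ L, a ∈ S := by
  induction L <;> simp_all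

theorem DisjRule.mem_vars [DecidableEq V] {R : DisjRule P V C} {v : V} :
    v ∈ R.vars ↔ v ∈ varsFS R.body ∨ ∃ H ∈ R.heads, v ∈ varsFS H := by
  have aux : ∀ L : List (Finset (FOAtom P V C)),
      v ∈ L.foldr (fun H acc => varsFS H ∪ acc) ∅ ↔ ∃ H ∈ L, v ∈ varsFS H := by
    intro L
    induction L <;> simp_all
  simp [DisjRule.vars, aux]

theorem applySubFS_subset_iff [DecidableEq P] [DecidableEq V] [DecidableEq C]
    {u : FOSubst V C} {S T : Finset (FOAtom P V C)} :
    applySubFS u S ⊆ T ↔ IsHom u S T := by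
  simp [applySubFS, IsHom, Finset.image_subset_iff]

theorem FOAtom.applySub_congr {u u' : FOSubst V C} {a : FOAtom P V C}
    (h : ∀ t ∈ a.args, t.applySub u = t.applySub u') : a.applySub u = a.applySub u' := by
  simp only [FOAtom.applySub, FOAtom.mk.injEq, true_and]
  exact List.map_congr_left h

theorem FOAtom.applySub_applySub {u θ : FOSubst V C} {r : TRel V C} (hu : IsAssocSub r u)
    (hr : ∀ s t, r s t → s.applySub θ = t.applySub θ) (a : FOAtom P V C) :
    (a.applySub u).applySub θ = a.applySub θ := by
  simp only [FOAtom.applySub, List.map_map, FOAtom.mk.injEq, true_and]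
  exact List.map_congr_left fun t _ => (hr _ _ (hu.2.1 t)).symm

/-- Equal images under `u` of two atoms are witnessed argumentwise. -/
theorem FOAtom.forall₂_of_applySub_eq {u : FOSubst V C} {a b : FOAtom P V C}
    (h : a.applySub u = b.applySub u) :
    a.pred = b.pred ∧ List.Forall₂ (fun s t => s.applySub u = t.applySub u) a.args b.args := by
  simp only [FOAtom.applySub, FOAtom.mk.injEq] at h
  refine ⟨h.1, ?_⟩
  have := List.forall₂_eq_eq_eq ▸ h.2
  rwa [List.forall₂_map_left_iff, List.forall₂_map_right_iff] at this

theorem List.Forall₂.imp_mem {α β : Type*} {r s : α → β → Prop} {l : List α} {m : List β}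
    (h : List.Forall₂ r l m) (hrs : ∀ a ∈ l, ∀ b ∈ m, r a b → s a b) : List.Forall₂ s l m := by
  induction h with
  | nil => exact .nil
  | cons hab _ ih =>
    refine .cons (hrs _ (by simp) _ (by simp) hab) (ih fun a ha b hb => hrs a ?_ b ?_) <;>
      simp [ha, hb]

theorem List.Forall₂.map_eq_map {α β γ : Type*} {f : α → γ} {g : β → γ} {l : List α}
    {m : List β} (h : List.Forall₂ (fun a b => f a = g b) l m) : l.map f = m.map g := by
  induction h with
  | nil => rfl
  | cons hab _ ih => simp [hab, ih]

theorem IsHom.apply_mem_termsFS [DecidableEq V] [DecidableEq C] {h : FOSubst V C}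
    {S F : Finset (FOAtom P V C)} (hh : IsHom h S F) {v : V} (hv : v ∈ varsFS S) :
    h v ∈ termsFS F := by
  obtain ⟨a, ha, hva⟩ := mem_varsFS.1 hv
  exact mem_termsFS.2 ⟨_, hh a ha, List.mem_map.2 ⟨_, hva, rfl⟩⟩

theorem var_mem_termsFS [DecidableEq V] [DecidableEq C] {S : Finset (FOAtom P V C)} {v : V} :
    FOTerm.var v ∈ termsFS S ↔ v ∈ varsFS S := by
  rw [mem_termsFS, mem_varsFS]

/-! ## Substitutions associated with partitions, and fresh renamings -/

theorem exists_isAssocSub {r : TRel V C} (he : Equivalence r) (ha : RelAdmissible r) :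
    ∃ u : FOSubst V C, IsAssocSub r u := by
  let s : Setoid (FOTerm V C) := ⟨r, he⟩
  have hsel : ∀ q : Quotient s, ∃ t : FOTerm V C, (⟦t⟧ : Quotient s) = q ∧
      ∀ c, (⟦FOTerm.const c⟧ : Quotient s) = q → t = FOTerm.const c := by
    intro q
    by_cases hc : ∃ c, (⟦FOTerm.const c⟧ : Quotient s) = q
    · obtain ⟨c, rfl⟩ := hc
      exact ⟨_, rfl, fun c' h => by rw [ha c' c (Quotient.exact h)]⟩
    · exact ⟨q.out, q.out_eq, fun c h => absurd ⟨c, h⟩ hc⟩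
  choose f hf hfc using hsel
  have key : ∀ t : FOTerm V C, t.applySub (fun v => f ⟦FOTerm.var v⟧) = f ⟦t⟧ := by
    rintro (v | c)
    · rfl
    · exact (hfc _ c rfl).symm
  refine ⟨fun v => f ⟦FOTerm.var v⟧, fun x y h => ?_, fun t => ?_, fun v c h => ?_⟩
  · rw [key, key, Quotient.sound (s := s) h]
  · rw [key]
    exact Quotient.exact (s := s) (hf _).symm
  · exact hfc _ c (Quotient.sound (s := s) (he.symm h))

theorem exists_fresh_renaming [Infinite V] (X : Finset V) :
    ∃ ρ : ℕ × V → V, Function.Injective ρ ∧ ∀ p, ρ p ∉ X := by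
  obtain ⟨e⟩ : Nonempty (ℕ × V ≃ V) := by
    rw [← Cardinal.eq]
    simp
  refine ⟨fun p => e (X.sup (fun x => (e.symm x).1) + 1 + p.1, p.2), fun p q h => ?_,
    fun p hp => ?_⟩
  · have := e.injective h
    simp only [Prod.mk.injEq, Nat.add_left_cancel_iff] at this
    exact Prod.ext this.1 this.2
  · have := Finset.le_sup (f := fun x => (e.symm x).1) hp
    simp only [Equiv.symm_apply_apply] at this
    omega

/-! ## Soundness of one rewriting step -/

theorem Interp.modelsFB_of_isPieceUnifier [DecidableEq P] [DecidableEq V] [DecidableEq C]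
    {Q B H : Finset (FOAtom P V C)} {μ : PieceUnif P V C} (hμ : IsPieceUnifier Q B H μ)
    (hdisj : Disjoint (varsFS Q) (varsFS H)) {I : Interp P V C} {b a : V → I.dom}
    (hrel : ∀ s t, μ.rel s t → I.evalT b s = I.evalT b t) (hb : I.satFS b (Q \ μ.Q'))
    (hab : ∀ v ∈ varsFS B, a v = b v) (ha : I.satFS a H) : I.modelsFB Q := by
  obtain ⟨-, hQ', hH', he, -, hadm, hpiece, hunif⟩ := hμ
  obtain ⟨u, hu⟩ := exists_isAssocSub he hadm
  have hnot : ∀ v ∈ varsFS Q, v ∉ varsFS μ.H' := fun v hv hv' =>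
    Finset.disjoint_left.1 hdisj hv (varsFS_mono hH' hv')
  have hvQ : ∀ v, FOTerm.var v ∈ termsFS μ.Q' → v ∈ varsFS Q := fun v hv =>
    varsFS_mono hQ' (var_mem_termsFS.1 hv)
  classical
  let ex : V → V → Prop := fun v z => z ∈ varsFS μ.H' \ varsFS B ∧
    μ.rel (FOTerm.var z) (FOTerm.var v)
  let c : V → I.dom := fun v => if h : ∃ z, ex v z then a h.choose else b v
  have hc : ∀ v, (¬ ∃ z, ex v z) → c v = b v := fun v h => dif_neg h
  refine ⟨c, fun q hq => ?_⟩
  by_cases hqQ' : q ∈ μ.Q'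
  · have hmem : q.applySub u ∈ applySubFS u μ.H' := by
      rw [← hunif u hu]
      exact Finset.mem_image_of_mem _ hqQ'
    obtain ⟨p, hp, hpq⟩ := Finset.mem_image.1 hmem
    obtain ⟨hpred, hargs⟩ := FOAtom.forall₂_of_applySub_eq hpq
    have hsat := ha p (hH' hp)
    have hmap : p.args.map (I.evalT a) = q.args.map (I.evalT c) := by
      refine (hargs.imp_mem fun t ht s hs hts => ?_).map_eq_map
      have hr : μ.rel t s :=
        he.trans (hu.2.1 t) (hts ▸ he.symm (hu.2.1 s))
      have hsvar : ∀ v, s = FOTerm.var v → v ∈ varsFS Q := fun v hv =>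
        mem_varsFS.2 ⟨q, hq, hv ▸ hs⟩
      by_cases hz : ∃ z ∈ varsFS μ.H' \ varsFS B, t = FOTerm.var z
      · obtain ⟨z, hz, rfl⟩ := hz
        obtain ⟨v, rfl⟩ : ∃ v, s = FOTerm.var v := by
          rcases hpiece z hz s hr with h | ⟨v, h, -⟩
          exacts [⟨z, h⟩, ⟨v, h⟩]
        have hex : ∃ z, ex v z := ⟨z, hz, hr⟩
        have hcv : c v = a hex.choose := dif_pos hex
        obtain ⟨hz₁, hz₂⟩ := hex.choose_spec
        have heq : hex.choose = z := by
          rcases hpiece z hz _ (he.trans hr (he.symm hz₂)) with h | ⟨w, h, hw, -⟩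
          · exact FOTerm.var.inj h
          · obtain rfl := FOTerm.var.inj h
            exact absurd (Finset.mem_sdiff.1 hz₁).1 (hnot _ (hvQ _ hw))
        simp only [Interp.evalT]
        rw [hcv, heq]
      · have hta : I.evalT a t = I.evalT b t := by
          cases t with
          | const k => rfl
          | var w =>
            refine hab w (by_contra fun hw => hz ⟨w, Finset.mem_sdiff.2 ⟨?_, hw⟩, rfl⟩)
            exact mem_varsFS.2 ⟨p, hp, ht⟩
        rw [hta, hrel _ _ hr]
        cases s with
        | const k => rfl
        | var v =>
          refine (hc v ?_).symm
          rintro ⟨z, hz₁, hz₂⟩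
          rcases hpiece z hz₁ t (he.trans hz₂ (he.symm hr)) with h | ⟨w, rfl, hw, -⟩
          · exact hz ⟨z, hz₁, h⟩
          · exact hnot _ (hvQ _ hw) (mem_varsFS.2 ⟨p, hp, ht⟩)
    unfold Interp.satAtom at hsat ⊢
    rwa [← hmap, ← hpred]
  · have hsat := hb q (Finset.mem_sdiff.2 ⟨hq, hqQ'⟩)
    have hmap : q.args.map (I.evalT c) = q.args.map (I.evalT b) := by
      refine List.map_congr_left ?_
      rintro (v | k) ht
      · refine hc v ?_
        rintro ⟨z, hz₁, hz₂⟩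
        rcases hpiece z hz₁ _ hz₂ with h | ⟨w, h, -, hw⟩
        · obtain rfl := FOTerm.var.inj h
          exact hnot v (mem_varsFS.2 ⟨q, hq, ht⟩) (Finset.mem_sdiff.1 hz₁).1
        · obtain rfl := FOTerm.var.inj h
          exact hw (mem_varsFS.2 ⟨q, Finset.mem_sdiff.2 ⟨hq, hqQ'⟩, ht⟩)
      · rfl
    unfold Interp.satAtom at hsat ⊢
    rwa [hmap]

theorem Interp.satAtom_applySub {I : Interp P V C} {u : FOSubst V C} {a : V → I.dom}
    {q : FOAtom P V C} :
    I.satAtom a (q.applySub u) ↔ I.satAtom (fun v => I.evalT a (u v)) q := by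
  have : I.evalT a ∘ FOTerm.applySub u = I.evalT (fun v => I.evalT a (u v)) := by
    funext t
    cases t <;> rfl
  simp [Interp.satAtom, FOAtom.applySub, this]

theorem Interp.evalT_applySub {I : Interp P V C} {u : FOSubst V C} {a : V → I.dom}
    (t : FOTerm V C) : I.evalT (fun v => I.evalT a (u v)) t = I.evalT a (t.applySub u) := by
  cases t <;> rfl

theorem mem_betaRw [DecidableEq P] [DecidableEq V] [DecidableEq C]
    {R : DisjRule P V C} {μ : DisjPieceUnif P V C} {u : FOSubst V C} {q : FOAtom P V C} :
    q ∈ betaRw R μ u ↔ q ∈ applySubFS u R.body ∨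
      ∃ (i : ℕ) (h₁ : i < μ.Qs.length) (h₂ : i < μ.mus.length),
        q ∈ applySubFS u (μ.Qs[i] \ μ.mus[i].Q') := by
  simp only [betaRw, Finset.mem_union, mem_foldr_union, List.mem_iff_getElem,
    List.length_zipWith, List.getElem_zipWith]
  refine or_congr_right ⟨?_, ?_⟩
  · rintro ⟨S, ⟨i, hi, rfl⟩, hq⟩
    exact ⟨i, by omega, by omega, hq⟩
  · rintro ⟨i, h₁, h₂, hq⟩
    exact ⟨_, ⟨i, by omega, rfl⟩, hq⟩

theorem Interp.exists_modelsFB_of_betaRw [DecidableEq P] [DecidableEq V] [DecidableEq C]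
    {𝒬 : Set (Finset (FOAtom P V C))} {R : DisjRule P V C} {μ : DisjPieceUnif P V C}
    {u : FOSubst V C} (hμ : IsDisjPieceUnifier 𝒬 R μ) (hu : IsAssocSub μ.rel u)
    {I : Interp P V C} (hI : I.modelsFB (betaRw R μ u)) (hR : I.satRule R) :
    ∃ Q ∈ 𝒬, I.modelsFB Q := by
  obtain ⟨hl₁, hl₂, hcopy, hdisj, -, hunif, -⟩ := hμ
  obtain ⟨a, ha⟩ := hI
  have hbody : I.satFS (fun v => I.evalT a (u v)) R.body := fun q hq =>
    Interp.satAtom_applySub.1 (ha _ (mem_betaRw.2 (.inl (Finset.mem_image_of_mem _ hq))))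
  obtain ⟨H, hH, a', hagree, ha'⟩ := hR _ hbody
  obtain ⟨i, hi, rfl⟩ := List.mem_iff_getElem.1 hH
  have h₁ : i < μ.Qs.length := by omega
  have h₂ : i < μ.mus.length := by omega
  have hmodel : I.modelsFB μ.Qs[i] := by
    refine Interp.modelsFB_of_isPieceUnifier (hunif i hi h₁ h₂) ?_ (fun s t hst => ?_)
      (fun q hq => ?_) hagree ha'
    · refine (hdisj i h₁).mono_right fun v hv => ?_
      exact DisjRule.mem_vars.2 (.inr ⟨_, hH, hv⟩)
    · rw [Interp.evalT_applySub, Interp.evalT_applySub, hu.1 s t]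
      exact .rel _ _ ⟨_, List.mem_map.2 ⟨_, List.getElem_mem h₂, rfl⟩, hst⟩
    · exact Interp.satAtom_applySub.1
        (ha _ (mem_betaRw.2 (.inr ⟨i, h₁, h₂, Finset.mem_image_of_mem _ hq⟩)))
  obtain ⟨Q, hQ, ρ, -, hρ⟩ := hcopy i h₁
  obtain ⟨b, hb⟩ := hmodel
  refine ⟨Q, hQ, fun v => I.evalT b (FOTerm.var (ρ v)), fun q hq =>
    Interp.satAtom_applySub (u := fun v => FOTerm.var (ρ v)).1 (hb _ ?_)⟩
  exact hρ.symm.subset (Finset.mem_image_of_mem _ hq)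

theorem semEntails_of_mem_Wop [DecidableEq P] [DecidableEq V] [DecidableEq C]
    {𝒬 : Finset (Finset (FOAtom P V C))} {ℛ : Set (DisjRule P V C)} {i : ℕ}
    {w : Finset (FOAtom P V C)} (hw : w ∈ Wop 𝒬 ℛ i) : SemEntails w ℛ ↑𝒬 := by
  induction i generalizing w with
  | zero => exact fun I hI _ => ⟨w, hw, hI⟩
  | succ i ih =>
    rcases hw with hw | ⟨R, hR, μ, u, hμ, hu, rfl⟩
    · exact ih hw
    · intro I hI hℛ
      obtain ⟨Q, hQ, hIQ⟩ := Interp.exists_modelsFB_of_betaRw hμ hu hI (hℛ R hR)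
      exact ih hQ I hIQ hℛ

/-! ## Completeness of the rewriting operator -/

theorem Wop_mono [DecidableEq P] [DecidableEq V] [DecidableEq C]
    (𝒬 : Finset (Finset (FOAtom P V C))) (ℛ : Set (DisjRule P V C)) : Monotone (Wop 𝒬 ℛ) :=
  monotone_nat_of_le_succ fun _ => Set.subset_union_left

/-- The piece-unifier induced by a homomorphism `θ` from `Q` to `F ∪ θ(H)`. -/
def homPieceUnif [DecidableEq P] [DecidableEq V] [DecidableEq C] (θ : FOSubst V C)
    (F Q H : Finset (FOAtom P V C)) : PieceUnif P V C where
  Q' := Q.filter fun a => a.applySub θ ∉ F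
  H' := H.filter fun b => b.applySub θ ∈ applySubFS θ (Q.filter fun a => a.applySub θ ∉ F)
  rel s t := s = t ∨
    ((s ∈ termsFS (Q.filter fun a => a.applySub θ ∉ F) ∪
        termsFS (H.filter fun b =>
          b.applySub θ ∈ applySubFS θ (Q.filter fun a => a.applySub θ ∉ F)) ∧
      t ∈ termsFS (Q.filter fun a => a.applySub θ ∉ F) ∪
        termsFS (H.filter fun b =>
          b.applySub θ ∈ applySubFS θ (Q.filter fun a => a.applySub θ ∉ F))) ∧
      s.applySub θ = t.applySub θ)

theorem applySub_eq_of_homPieceUnif_rel [DecidableEq P] [DecidableEq V] [DecidableEq C]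
    {θ : FOSubst V C} {F Q H : Finset (FOAtom P V C)} {s t : FOTerm V C}
    (h : (homPieceUnif θ F Q H).rel s t) : s.applySub θ = t.applySub θ := by
  rcases h with rfl | h
  exacts [rfl, h.2]

theorem isPieceUnifier_homPieceUnif [DecidableEq P] [DecidableEq V] [DecidableEq C]
    {θ : FOSubst V C} {F Q B H : Finset (FOAtom P V C)} (hQF : ¬ IsHom θ Q F)
    (hQ : IsHom θ Q (F ∪ applySubFS θ H)) (hB : IsHom θ B F)
    (hfresh : ∀ z ∈ varsFS H \ varsFS B, ∃ x, θ z = FOTerm.var x ∧ x ∉ varsFS F)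
    (hinj : ∀ z ∈ varsFS H \ varsFS B, ∀ z' ∈ varsFS H \ varsFS B, θ z = θ z' → z = z') :
    IsPieceUnifier Q B H (homPieceUnif θ F Q H) := by
  set μ := homPieceUnif θ F Q H
  have hQ'_mem : ∀ {a}, a ∈ μ.Q' ↔ a ∈ Q ∧ a.applySub θ ∉ F := Finset.mem_filter
  have hH'_mem : ∀ {b}, b ∈ μ.H' ↔ b ∈ H ∧ b.applySub θ ∈ applySubFS θ μ.Q' :=
    Finset.mem_filter
  have hH' : μ.H' ⊆ H := Finset.filter_subset _ _
  have hrel : ∀ {s t}, μ.rel s t ↔ s = t ∨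
      ((s ∈ termsFS μ.Q' ∪ termsFS μ.H' ∧ t ∈ termsFS μ.Q' ∪ termsFS μ.H') ∧
        s.applySub θ = t.applySub θ) := Iff.rfl
  have hunif : ∀ u, IsAssocSub μ.rel u → ∀ a ∈ μ.Q', ∀ b ∈ μ.H',
      a.applySub θ = b.applySub θ → a.applySub u = b.applySub u := by
    intro u hu a ha b hb hab
    obtain ⟨hpred, hargs⟩ := FOAtom.forall₂_of_applySub_eq hab
    simp only [FOAtom.applySub, FOAtom.mk.injEq]
    refine ⟨hpred, (hargs.imp_mem fun s hs t ht hst => hu.1 s t (.inr ⟨⟨?_, ?_⟩, hst⟩)).map_eq_map⟩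
    · exact Finset.mem_union_left _ (mem_termsFS.2 ⟨a, ha, hs⟩)
    · exact Finset.mem_union_right _ (mem_termsFS.2 ⟨b, hb, ht⟩)
  refine ⟨?_, Finset.filter_subset _ _, hH', ⟨fun _ => .inl rfl, ?_, ?_⟩, ?_, ?_, ?_, ?_⟩
  · simp only [IsHom, not_forall] at hQF
    obtain ⟨a, ha, haF⟩ := hQF
    exact ⟨a, hQ'_mem.2 ⟨ha, haF⟩⟩
  · rintro s t (rfl | ⟨⟨hs, ht⟩, h⟩)
    exacts [.inl rfl, .inr ⟨⟨ht, hs⟩, h.symm⟩]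
  · rintro s t r (rfl | ⟨⟨hs, ht⟩, h⟩) (rfl | ⟨⟨ht', hr⟩, h'⟩)
    exacts [.inl rfl, .inr ⟨⟨ht', hr⟩, h'⟩, .inr ⟨⟨hs, ht⟩, h⟩, .inr ⟨⟨hs, hr⟩, h.trans h'⟩]
  · rintro s t (h | h)
    exacts [.inl h, .inr h.1]
  · intro c c' h
    exact FOTerm.const.inj (applySub_eq_of_homPieceUnif_rel h)
  · intro z hz t hzt
    have hz' : z ∈ varsFS H \ varsFS B := Finset.sdiff_subset_sdiff (varsFS_mono hH') subset_rfl hz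
    obtain ⟨x, hx, hxF⟩ := hfresh z hz'
    have hθ : FOTerm.var x = t.applySub θ := hx ▸ applySub_eq_of_homPieceUnif_rel hzt
    rcases hrel.1 hzt with h | ⟨⟨-, ht⟩, -⟩
    · exact .inl h.symm
    cases t with
    | const c => cases hθ
    | var v =>
      have hθv : θ v = FOTerm.var x := hθ.symm
      rcases Finset.mem_union.1 ht with ht | ht
      · refine .inr ⟨v, rfl, ht, fun hv => hxF ?_⟩
        have hF : IsHom θ (Q \ μ.Q') F := fun a ha => by
          by_contra haF
          obtain ⟨haQ, haQ'⟩ := Finset.mem_sdiff.1 ha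
          exact haQ' (hQ'_mem.2 ⟨haQ, haF⟩)
        exact var_mem_termsFS.1 (hθv ▸ hF.apply_mem_termsFS hv)
      · have hvB : v ∉ varsFS B := fun hv =>
          hxF (var_mem_termsFS.1 (hθv ▸ hB.apply_mem_termsFS hv))
        have hvH := varsFS_mono hH' (var_mem_termsFS.1 ht)
        exact .inl (congrArg _ (hinj v (Finset.mem_sdiff.2 ⟨hvH, hvB⟩) z hz' (hθv.trans hx.symm)))
  · intro u hu
    refine Finset.Subset.antisymm (applySubFS_subset_iff.2 fun a ha => ?_)
      (applySubFS_subset_iff.2 fun b hb => ?_)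
    · obtain ⟨haQ, haF⟩ := hQ'_mem.1 ha
      obtain ⟨b, hb, hab⟩ := Finset.mem_image.1 ((Finset.mem_union.1 (hQ a haQ)).resolve_left haF)
      have hb' : b ∈ μ.H' := hH'_mem.2 ⟨hb, hab ▸ Finset.mem_image_of_mem _ ha⟩
      exact hunif u hu a ha b hb' hab.symm ▸ Finset.mem_image_of_mem _ hb'
    · obtain ⟨a, ha, hab⟩ := Finset.mem_image.1 (hH'_mem.1 hb).2
      exact hunif u hu a ha b hb hab ▸ Finset.mem_image_of_mem _ ha

/-- No CQ produced by the operator `W` is entailed by `F`. -/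
def AvoidsWop [DecidableEq P] [DecidableEq V] [DecidableEq C]
    (𝒬 : Finset (Finset (FOAtom P V C))) (ℛ : Set (DisjRule P V C))
    (F : Finset (FOAtom P V C)) : Prop :=
  ∀ i, ∀ w ∈ Wop 𝒬 ℛ i, ¬ EntailsFS F w

theorem applySub_renaming {ρ : V → V} {g θ : FOSubst V C} (h : ∀ v, θ (ρ v) = g v)
    (a : FOAtom P V C) :
    (a.applySub fun v => FOTerm.var (ρ v)).applySub θ = a.applySub g := by
  simp only [FOAtom.applySub, List.map_map, FOAtom.mk.injEq, true_and]
  refine List.map_congr_left ?_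
  rintro (v | c) _
  exacts [h v, rfl]

theorem mem_varsFS_renaming [DecidableEq P] [DecidableEq V] [DecidableEq C] {ρ : V → V}
    {Q : Finset (FOAtom P V C)} {v : V}
    (hv : v ∈ varsFS (Q.image (FOAtom.applySub fun v => FOTerm.var (ρ v)))) :
    ∃ w, ρ w = v := by
  obtain ⟨a, ha, hva⟩ := mem_varsFS.1 hv
  obtain ⟨b, -, rfl⟩ := Finset.mem_image.1 ha
  obtain ⟨w | c, -, hw⟩ := List.mem_map.1 hva
  · exact ⟨w, FOTerm.var.inj hw⟩
  · cases hw

/-- Applying a rule to a fact base avoiding `W` yields, for some head disjunct, a fact base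
avoiding `W`. -/
theorem AvoidsWop.exists_head [DecidableEq P] [DecidableEq V] [DecidableEq C] [Infinite V]
    {𝒬 : Finset (Finset (FOAtom P V C))} {ℛ : Set (DisjRule P V C)}
    {F : Finset (FOAtom P V C)} (hF : AvoidsWop 𝒬 ℛ F) {R : DisjRule P V C} (hR : R ∈ ℛ)
    {h : FOSubst V C} (hh : IsTrigger R h F) :
    ∃ H ∈ R.heads, ∃ h' : FOSubst V C, (∀ v ∈ varsFS R.body, h' v = h v) ∧
      AvoidsWop 𝒬 ℛ (F ∪ applySubFS h' H) := by
  by_contra hcon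
  push Not at hcon
  obtain ⟨σ, hσinj, hσF⟩ := exists_fresh_renaming (varsFS F)
  let h' : FOSubst V C := fun v => if v ∈ varsFS R.body then h v else FOTerm.var (σ (0, v))
  have hh'body : ∀ v ∈ varsFS R.body, h' v = h v := fun v hv => if_pos hv
  have hh'ex : ∀ v, v ∉ varsFS R.body → h' v = FOTerm.var (σ (0, v)) := fun v hv => if_neg hv
  have hw : ∀ i : Fin R.heads.length, ∃ k, ∃ w ∈ Wop 𝒬 ℛ k, ∃ g : FOSubst V C,
      IsHom g w (F ∪ applySubFS h' R.heads[i]) := by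
    intro i
    have := hcon _ (List.getElem_mem i.2) h' hh'body
    simp only [AvoidsWop, not_forall, not_not] at this
    obtain ⟨k, w, hw, g, hg⟩ := this
    exact ⟨k, w, hw, g, hg⟩
  choose k w hw g hg using hw
  let K := Finset.univ.sup k
  have hwK : ∀ i, w i ∈ Wop 𝒬 ℛ K := fun i =>
    Wop_mono 𝒬 ℛ (Finset.le_sup (Finset.mem_univ i)) (hw i)
  obtain ⟨ρ, hρinj, hρR⟩ := exists_fresh_renaming R.vars
  have hρinj' : Function.Injective fun p : Fin R.heads.length × V => ρ (p.1, p.2) := by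
    intro p q hpq
    have := hρinj hpq
    simp only [Prod.mk.injEq] at this
    exact Prod.ext (Fin.ext this.1) this.2
  let θ : FOSubst V C := fun v => if v ∈ R.vars then h' v else
    Function.extend (fun p : Fin R.heads.length × V => ρ (p.1, p.2)) (fun p => g p.1 p.2)
      FOTerm.var v
  have hθR : ∀ v ∈ R.vars, θ v = h' v := fun v hv => if_pos hv
  have hθρ : ∀ (i : Fin R.heads.length) v, θ (ρ (i, v)) = g i v := fun i v =>
    (if_neg (hρR _)).trans (hρinj'.extend_apply (fun p => g p.1 p.2) _ (i, v))
  have hbodyvars : varsFS R.body ⊆ R.vars := fun v hv => DisjRule.mem_vars.2 (.inl hv)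
  have hheadvars : ∀ i : Fin R.heads.length, varsFS R.heads[i] ⊆ R.vars := fun i v hv =>
    DisjRule.mem_vars.2 (.inr ⟨_, List.getElem_mem i.2, hv⟩)
  have hθbody : IsHom θ R.body F := by
    intro a ha
    have : a.applySub θ = a.applySub h := by
      refine FOAtom.applySub_congr ?_
      rintro (v | c) ht
      · have hv : v ∈ varsFS R.body := mem_varsFS.2 ⟨a, ha, ht⟩
        exact (hθR v (hbodyvars hv)).trans (hh'body v hv)
      · rfl
    exact this ▸ hh a ha
  have hθhead : ∀ i : Fin R.heads.length,
      applySubFS θ R.heads[i] = applySubFS h' R.heads[i] := by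
    intro i
    refine Finset.image_congr fun a ha => FOAtom.applySub_congr ?_
    rintro (v | c) ht
    · exact hθR v (hheadvars i (mem_varsFS.2 ⟨a, ha, ht⟩))
    · rfl
  let Qc : Fin R.heads.length → Finset (FOAtom P V C) := fun i =>
    (w i).image (FOAtom.applySub fun v => FOTerm.var (ρ (i, v)))
  have hQcvars : ∀ i v, v ∈ varsFS (Qc i) → ∃ x, ρ (i, x) = v := fun i v hv =>
    mem_varsFS_renaming hv
  have hhomQc : ∀ i S, IsHom θ (Qc i) S ↔ IsHom (g i) (w i) S := by
    intro i S
    simp only [IsHom, Qc, Finset.forall_mem_image, applySub_renaming (hθρ i)]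
  let m : Fin R.heads.length → PieceUnif P V C := fun i => homPieceUnif θ F (Qc i) R.heads[i]
  have hm : ∀ i, IsPieceUnifier (Qc i) R.body R.heads[i] (m i) := by
    intro i
    refine isPieceUnifier_homPieceUnif ?_ ?_ hθbody ?_ ?_
    · rw [hhomQc]
      exact fun hgF => hF _ _ (hwK i) ⟨g i, hgF⟩
    · rw [hhomQc, hθhead]
      exact hg i
    · intro z hz
      obtain ⟨hzH, hzB⟩ := Finset.mem_sdiff.1 hz
      exact ⟨_, (hθR z (hheadvars i hzH)).trans (hh'ex z hzB), hσF _⟩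
    · intro z hz z' hz' hzz'
      obtain ⟨hzH, hzB⟩ := Finset.mem_sdiff.1 hz
      obtain ⟨hzH', hzB'⟩ := Finset.mem_sdiff.1 hz'
      rw [hθR z (hheadvars i hzH), hθR z' (hheadvars i hzH'), hh'ex z hzB, hh'ex z' hzB'] at hzz'
      exact (Prod.mk.inj (hσinj (FOTerm.var.inj hzz'))).2
  let μ : DisjPieceUnif P V C := ⟨List.ofFn Qc, List.ofFn m⟩
  have hker : ∀ s t, μ.rel s t → s.applySub θ = t.applySub θ := by
    intro s t hst
    induction hst with
    | rel s t hst =>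
      obtain ⟨r, hr, hst⟩ := hst
      obtain ⟨x, hx, rfl⟩ := List.mem_map.1 hr
      obtain ⟨i, rfl⟩ := (List.mem_ofFn' _ _).1 hx
      exact applySub_eq_of_homPieceUnif_rel hst
    | refl => rfl
    | symm _ _ _ ih => exact ih.symm
    | trans _ _ _ _ _ ih₁ ih₂ => exact ih₁.trans ih₂
  have hadm : RelAdmissible μ.rel := fun c c' hcc' => FOTerm.const.inj (hker _ _ hcc')
  obtain ⟨u, hu⟩ := exists_isAssocSub (Relation.EqvGen.is_equivalence _) hadm
  have hμ : IsDisjPieceUnifier (Wop 𝒬 ℛ K) R μ := by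
    refine ⟨List.length_ofFn, List.length_ofFn, ?_, ?_, ?_, ?_, hadm⟩
    · intro i hi
      refine ⟨_, hwK ⟨i, by simpa [μ] using hi⟩, fun v => ρ (i, v), fun v v' hvv' => ?_, ?_⟩
      · exact (Prod.mk.inj (hρinj hvv')).2
      · simp [μ, Qc]
    · intro i hi
      simp only [μ, List.get_ofFn]
      refine Finset.disjoint_left.2 fun v hv => ?_
      obtain ⟨x, rfl⟩ := hQcvars _ _ hv
      exact hρR _
    · intro i j hi hj hij
      simp only [μ, List.get_ofFn]
      refine Finset.disjoint_left.2 fun v hv hv' => ?_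
      obtain ⟨x, rfl⟩ := hQcvars _ _ hv
      obtain ⟨y, hy⟩ := hQcvars _ _ hv'
      exact hij (Prod.mk.inj (hρinj hy)).1.symm
    · intro i hi hi₁ hi₂
      simpa [μ] using hm ⟨i, hi⟩
  refine hF (K + 1) (betaRw R μ u) (.inr ⟨R, hR, μ, u, hμ, hu, rfl⟩) ⟨θ, fun q hq => ?_⟩
  rcases mem_betaRw.1 hq with hq | ⟨i, hi₁, hi₂, hq⟩
  · obtain ⟨a, ha, rfl⟩ := Finset.mem_image.1 hq
    rw [FOAtom.applySub_applySub hu hker]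
    exact hθbody a ha
  · obtain ⟨a, ha, rfl⟩ := Finset.mem_image.1 hq
    rw [FOAtom.applySub_applySub hu hker]
    simp only [μ, List.getElem_ofFn, m, homPieceUnif, Finset.mem_sdiff, Finset.mem_filter,
      not_and, not_not] at ha
    exact ha.2 ha.1

theorem isHom_var (S : Finset (FOAtom P V C)) : IsHom FOTerm.var S S := by
  have : FOTerm.applySub (FOTerm.var : FOSubst V C) = id := by
    funext t
    cases t <;> rfl
  intro a ha
  simpa [FOAtom.applySub, this] using ha

theorem IsHom.mono {h : FOSubst V C} {S F F' : Finset (FOAtom P V C)} (hh : IsHom h S F)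
    (hF : F ⊆ F') : IsHom h S F' :=
  fun a ha => hF (hh a ha)

/-- The trigger `(R, h)` is satisfied in `F`. -/
def TriggerSatisfied [DecidableEq V] (R : DisjRule P V C) (h : FOSubst V C)
    (F : Finset (FOAtom P V C)) : Prop :=
  ∃ H ∈ R.heads, ∃ h' : FOSubst V C, (∀ v ∈ varsFS R.body, h' v = h v) ∧ IsHom h' H F

theorem AvoidsWop.exists_satisfying_finset [DecidableEq P] [DecidableEq V] [DecidableEq C]
    [Infinite V] {𝒬 : Finset (Finset (FOAtom P V C))} {ℛ : Set (DisjRule P V C)}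
    {F : Finset (FOAtom P V C)} (hF : AvoidsWop 𝒬 ℛ F)
    {T : Set (DisjRule P V C × FOSubst V C)} (hfin : T.Finite)
    (hT : ∀ p ∈ T, p.1 ∈ ℛ ∧ IsTrigger p.1 p.2 F) :
    ∃ F', F ⊆ F' ∧ AvoidsWop 𝒬 ℛ F' ∧ ∀ p ∈ T, TriggerSatisfied p.1 p.2 F' := by
  induction T, hfin using Set.Finite.induction_on with
  | empty => exact ⟨F, subset_rfl, hF, by simp⟩
  | @insert p T _ _ ih =>
    obtain ⟨F₁, hFF₁, hF₁, hsat⟩ := ih fun p hp => hT p (.inr hp)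
    obtain ⟨hR, htr⟩ := hT p (.inl rfl)
    obtain ⟨H, hH, h', hagree, hF₂⟩ := hF₁.exists_head hR (htr.mono hFF₁)
    refine ⟨_, hFF₁.trans Finset.subset_union_left, hF₂, ?_⟩
    rintro q (rfl | hq)
    · exact ⟨H, hH, h', hagree, applySubFS_subset_iff.1 Finset.subset_union_right⟩
    · obtain ⟨H, hH, h', hagree, hh'⟩ := hsat q hq
      exact ⟨H, hH, h', hagree, hh'.mono Finset.subset_union_left⟩

/-- One parallel chase step, along a branch avoiding `W`. -/
theorem AvoidsWop.exists_satisfying [DecidableEq P] [DecidableEq V] [DecidableEq C]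
    [Infinite V] {𝒬 : Finset (Finset (FOAtom P V C))} {ℛ : Set (DisjRule P V C)}
    (hfin : ℛ.Finite) {F : Finset (FOAtom P V C)} (hF : AvoidsWop 𝒬 ℛ F) :
    ∃ F', F ⊆ F' ∧ AvoidsWop 𝒬 ℛ F' ∧
      ∀ R ∈ ℛ, ∀ h, IsTrigger R h F → TriggerSatisfied R h F' := by
  let ext : (R : DisjRule P V C) → (varsFS R.body → termsFS F) → FOSubst V C := fun R f v =>
    if hv : v ∈ varsFS R.body then (f ⟨v, hv⟩ : FOTerm V C) else FOTerm.var v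
  let T : Set (DisjRule P V C × FOSubst V C) :=
    {p | p.1 ∈ ℛ ∧ IsTrigger p.1 p.2 F ∧ p.2 ∈ Set.range (ext p.1)}
  have hTfin : T.Finite := by
    refine (hfin.biUnion fun R _ => (Set.finite_range (ext R)).image (Prod.mk R)).subset ?_
    rintro ⟨R, h⟩ ⟨hR, -, hh⟩
    exact Set.mem_biUnion hR ⟨h, hh, rfl⟩
  obtain ⟨F', hFF', hF', hsat⟩ := hF.exists_satisfying_finset hTfin fun p hp => ⟨hp.1, hp.2.1⟩
  refine ⟨F', hFF', hF', fun R hR h hh => ?_⟩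
  let f : varsFS R.body → termsFS F := fun v => ⟨h v, IsHom.apply_mem_termsFS hh v.2⟩
  let h₀ : FOSubst V C := ext R f
  have hh₀ : ∀ v ∈ varsFS R.body, h₀ v = h v := fun v hv => dif_pos hv
  have htr : IsTrigger R h₀ F := by
    intro a ha
    have : a.applySub h₀ = a.applySub h := by
      refine FOAtom.applySub_congr ?_
      rintro (v | c) ht
      exacts [hh₀ v (mem_varsFS.2 ⟨a, ha, ht⟩), rfl]
    exact this ▸ hh a ha
  obtain ⟨H, hH, h', hagree, hh'⟩ := hsat (R, h₀) ⟨hR, htr, f, rfl⟩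
  exact ⟨H, hH, h', fun v hv => (hagree v hv).trans (hh₀ v hv), hh'⟩

/-- The Herbrand-like interpretation given by the union of a sequence of fact bases. -/
def unionInterp [Nonempty V] (F : ℕ → Finset (FOAtom P V C)) : Interp P V C where
  dom := FOTerm V C
  nonempty := ‹Nonempty V›.map FOTerm.var
  rel p l := ∃ k, ⟨p, l⟩ ∈ F k
  cst := FOTerm.const

theorem unionInterp_satFS_iff [Nonempty V] {F : ℕ → Finset (FOAtom P V C)} (hF : Monotone F)
    {a : FOSubst V C} {S : Finset (FOAtom P V C)} :
    (unionInterp F).satFS a S ↔ ∃ k, IsHom a S (F k) := by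
  have heval : (unionInterp F).evalT a = FOTerm.applySub a := by
    funext t
    cases t <;> rfl
  have hatom : ∀ q, (unionInterp F).satAtom a q ↔ ∃ k, q.applySub a ∈ F k := fun q => by
    unfold Interp.satAtom
    rw [heval]
    rfl
  simp only [Interp.satFS, hatom]
  constructor
  · intro h
    choose! k hk using h
    exact ⟨S.sup k, fun q hq => hF (Finset.le_sup hq) (hk q hq)⟩
  · rintro ⟨k, hk⟩ q hq
    exact ⟨k, hk q hq⟩

theorem exists_mem_Wop_of_semEntails [DecidableEq P] [DecidableEq V] [DecidableEq C]
    [Infinite V] {𝒬 : Finset (Finset (FOAtom P V C))} {ℛ : Set (DisjRule P V C)}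
    (hfin : ℛ.Finite) {F : Finset (FOAtom P V C)} (hF : SemEntails F ℛ ↑𝒬) :
    ∃ i, ∃ w ∈ Wop 𝒬 ℛ i, EntailsFS F w := by
  by_contra hcon
  have hav : AvoidsWop 𝒬 ℛ F := fun i w hw hFw => hcon ⟨i, w, hw, hFw⟩
  choose next hsub hnext hsat using
    fun G : {G // AvoidsWop 𝒬 ℛ G} => G.2.exists_satisfying hfin
  let chase : ℕ → {G // AvoidsWop 𝒬 ℛ G} := fun n =>
    (fun G => ⟨next G, hnext G⟩)^[n] ⟨F, hav⟩
  have hsucc : ∀ n, (chase (n + 1)).1 = next (chase n) := fun n => by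
    simp only [chase, Function.iterate_succ_apply']
  have hmono : Monotone fun n => (chase n).1 :=
    monotone_nat_of_le_succ fun n => by
      rw [hsucc]
      exact hsub _
  obtain ⟨Q, hQ, a, ha⟩ := hF (unionInterp fun n => (chase n).1)
    ⟨FOTerm.var, (unionInterp_satFS_iff hmono).2 ⟨0, isHom_var F⟩⟩
    (fun R hR a ha => by
      obtain ⟨k, hk⟩ := (unionInterp_satFS_iff hmono).1 ha
      obtain ⟨H, hH, h', hagree, hh'⟩ := hsat (chase k) R hR a hk
      exact ⟨H, hH, h', hagree, (unionInterp_satFS_iff hmono).2 ⟨k + 1, hsucc k ▸ hh'⟩⟩)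
  obtain ⟨k, hk⟩ := (unionInterp_satFS_iff hmono).1 ha
  exact (chase k).2 0 Q hQ ⟨a, hk⟩

/-- if `(𝒬, ℛ)` admits a UCQ-rewriting `𝒬'` (a finite complete
rewriting), then there is an `i ≥ 0` such that `𝒬'` is logically equivalent to
`Wᵢ(𝒬, ℛ)`. -/
theorem stmt10 {P V C : Type} [DecidableEq P] [DecidableEq V] [DecidableEq C] [Infinite V]
    (𝒬 : Finset (Finset (FOAtom P V C))) (ℛ : Set (DisjRule P V C))
    (hfin : ℛ.Finite) (hWF : ∀ R ∈ ℛ, R.WF)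
    (𝒬' : Finset (Finset (FOAtom P V C)))
    -- 𝒬' is a (sound) rewriting of 𝒬 with ℛ
    (hsound : ∀ F : Finset (FOAtom P V C),
      (∃ q ∈ 𝒬', EntailsFS F q) → SemEntails F ℛ (↑𝒬 : Set (Finset (FOAtom P V C))))
    -- 𝒬' is complete
    (hcomplete : ∀ F : Finset (FOAtom P V C),
      SemEntails F ℛ (↑𝒬 : Set (Finset (FOAtom P V C))) → ∃ q ∈ 𝒬', EntailsFS F q) :
    -- 𝒬' is logically equivalent to some W_i(𝒬, ℛ)
    ∃ i : ℕ,
      (∀ q ∈ 𝒬', ∃ w ∈ Wop 𝒬 ℛ i, EntailsFS q w) ∧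
      (∀ w ∈ Wop 𝒬 ℛ i, ∃ q ∈ 𝒬', EntailsFS w q) := by
  have hq : ∀ q ∈ 𝒬', ∃ i, ∃ w ∈ Wop 𝒬 ℛ i, EntailsFS q w := fun q hq =>
    exists_mem_Wop_of_semEntails hfin (hsound q ⟨q, hq, FOTerm.var, isHom_var q⟩)
  choose! k hk using hq
  refine ⟨𝒬'.sup k, fun q hq => ?_, fun w hw => hcomplete w (semEntails_of_mem_Wop hw)⟩
  obtain ⟨w, hw, hqw⟩ := hk q hq
  exact ⟨w, Wop_mono 𝒬 ℛ (Finset.le_sup hq) hw, hqw⟩
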